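/- Let d ≥ 1 and σ a state on ℂ^d. For ε₁, ε₂ ∈ (0,1], the majorization-minimal states satisfy the semigroup property ρ*_{ε₁+ε₂}(σ) = ρ*_{ε₁}(ρ*_{ε₂}(σ)). -/

import Mathlib

open scoped BigOperators ComplexOrder

noncomputable section

/-- A quantum state on `ℂ^d`: a positive semidefinite `d × d` complex matrix of trace 1. -/
def MState (d : ℕ) : Type :=
  {m : Matrix (Fin d) (Fin d) ℂ // m.PosSemidef ∧ m.trace = 1}

/-- Eigenvalues of a matrix (junk value `0` if the matrix is not Hermitian). -/
noncomputable def eigs {d : ℕ} (A : Matrix (Fin d) (Fin d) ℂ) : Fin d → ℝ :=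
  if h : A.IsHermitian then h.eigenvalues else 0

/-- The trace norm of a Hermitian matrix: the sum of the absolute values of its eigenvalues. -/
noncomputable def traceNorm {d : ℕ} (A : Matrix (Fin d) (Fin d) ℂ) : ℝ :=
  ∑ i, |eigs A i|

/-- Membership in the ε-ball (in trace distance) around the state `σ`:
`ω ∈ B_ε(σ) ↔ (1/2)‖ω − σ‖₁ ≤ ε`. -/
def inBall {d : ℕ} (ε : ℝ) (σ ω : MState d) : Prop :=
  (1 / 2 : ℝ) * traceNorm (ω.1 - σ.1) ≤ ε

/-- Sum of the `k` largest entries of a vector (counted with multiplicity). -/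
noncomputable def kMaxSum {d : ℕ} (v : Fin d → ℝ) (k : ℕ) : ℝ :=
  sSup ((fun s : Finset (Fin d) => ∑ i ∈ s, v i) '' {s | s.card = k})

/-- Vector majorization `x ≺ y`: for each `k = 1, …, d` the sum of the `k` largest entries of
`x` is at most that of `y`, with equality at `k = d`. -/
def vMaj {d : ℕ} (x y : Fin d → ℝ) : Prop :=
  (∀ k, 1 ≤ k → k ≤ d → kMaxSum x k ≤ kMaxSum y k) ∧ kMaxSum x d = kMaxSum y d

/-- State majorization `ρ ≺ σ` (majorization of the eigenvalue vectors). -/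
def Maj {d : ℕ} (ρ σ : MState d) : Prop :=
  vMaj (eigs ρ.1) (eigs σ.1)

/-- Two states are unitarily equivalent iff they have the same eigenvalues with the same
multiplicities. -/
def UnitarilyEquiv {d : ℕ} (ρ σ : MState d) : Prop :=
  ∃ π : Equiv.Perm (Fin d), eigs ρ.1 = eigs σ.1 ∘ π

/-- The von Neumann entropy (base 2): the Shannon entropy of the eigenvalues. -/
noncomputable def vnEnt {d : ℕ} (ρ : MState d) : ℝ :=
  -∑ i, eigs ρ.1 i * Real.logb 2 (eigs ρ.1 i)

/-- The completely mixed state matrix `(1/d)·I`. -/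
noncomputable def mixedMat (d : ℕ) : Matrix (Fin d) (Fin d) ℂ :=
  ((d : ℂ)⁻¹) • 1

/-- `ρ` is the majorization-minimal state `ρ*_ε(σ)` of the ε-ball around `σ`:
`ρ ∈ B_ε(σ)` and `ρ ≺ ω` for every `ω ∈ B_ε(σ)`. -/
def IsMinState {d : ℕ} (ε : ℝ) (σ ρ : MState d) : Prop :=
  inBall ε σ ρ ∧ ∀ ω : MState d, inBall ε σ ω → Maj ρ ω

open Matrix

lemma aux_abel (g a : ℕ → ℝ) (n : ℕ) (hg : ∀ i, i < n → g (i + 1) ≤ g i)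
    (ha : ∀ k, k ≤ n + 1 → 0 ≤ ∑ i ∈ Finset.range k, a i) :
    g n * ∑ i ∈ Finset.range (n + 1), a i ≤ ∑ i ∈ Finset.range (n + 1), g i * a i := by
  induction n with
  | zero => simp
  | succ n ih =>
    have h1 := ih (fun i hi => hg i (by omega)) (fun k hk => ha k (by omega))
    rw [Finset.sum_range_succ, Finset.sum_range_succ (fun i => g i * a i)]
    have h2 := ha (n + 1) (by omega)
    have h3 := hg n (by omega)
    nlinarith [mul_le_mul_of_nonneg_right h3 h2]

lemma aux_abel_fin {d : ℕ} (g a : Fin d → ℝ) (hg : Antitone g)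
    (ha : ∀ k, k ≤ d → 0 ≤ ∑ i with i.val < k, a i) (h0 : ∑ i, a i = 0) :
    0 ≤ ∑ i, g i * a i := by
  rcases d with _ | n
  · simp
  let e : ∀ f : Fin (n + 1) → ℝ, ℕ → ℝ := fun f i => if h : i < n + 1 then f ⟨i, h⟩ else 0
  have hs : ∀ f : Fin (n + 1) → ℝ, ∀ k, k ≤ n + 1 →
      ∑ i ∈ Finset.range k, e f i = ∑ i with i.val < k, f i := by
    intro f k hk
    symm
    refine Finset.sum_bij (fun i _ => i.val) ?_ ?_ ?_ ?_
    · intro i hi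
      simpa using hi
    · intro i _ j _ h
      exact Fin.ext h
    · intro b hb
      have hb' := Finset.mem_range.1 hb
      exact ⟨⟨b, by omega⟩, by simpa using hb', rfl⟩
    · intro i _
      have h := i.isLt
      simp only [e, h, dif_pos]
  have key := aux_abel (e g) (e a) n (by
    intro i hi
    have h1 : i < n + 1 := by omega
    have h2 : i + 1 < n + 1 := by omega
    simp only [e, h1, h2, dif_pos]
    exact hg (by simp [Fin.le_def])) (fun k hk => by rw [hs a k hk]; exact ha k hk)
  have hall : ∀ f : Fin (n + 1) → ℝ, ∑ i ∈ Finset.range (n + 1), e f i = ∑ i, f i := by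
    intro f
    rw [hs f _ le_rfl]
    congr 1
    ext i
    have h := i.isLt
    simp only [Finset.mem_filter, Finset.mem_univ, true_and, iff_true, h]
  rw [hall a, h0, mul_zero] at key
  have h2 : ∀ i, e g i * e a i = e (fun i => g i * a i) i := by
    intro i
    simp only [e]
    split_ifs <;> simp
  simp_rw [h2] at key
  have h3 := hall (fun i => g i * a i)
  linarith

lemma aux_prefix {d : ℕ} (z : Fin d → ℝ) (hz : Antitone z) (s : Finset (Fin d)) :
    ∑ i ∈ s, z i ≤ ∑ i with i.val < s.card, z i := by
  classical
  rcases Nat.eq_zero_or_pos s.card with h | h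
  · rw [Finset.card_eq_zero] at h
    simp [h]
  set F : Finset (Fin d) := Finset.univ.filter (fun i => i.val < s.card) with hF
  have hsd : s.card ≤ d := by simpa using Finset.card_le_univ s
  have hFc : F.card = s.card := by
    have : F.card = (Finset.range s.card).card := by
      refine Finset.card_bij (fun i _ => i.val) ?_ ?_ ?_
      · intro i hi
        simpa [hF] using hi
      · intro i _ j _ h
        exact Fin.ext h
      · intro b hb
        have hb' := Finset.mem_range.1 hb
        exact ⟨⟨b, by omega⟩, by simpa [hF] using hb', rfl⟩
    simpa using this
  let t : Fin d := ⟨s.card - 1, by omega⟩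
  have h1 : ∑ i ∈ s \ F, z i ≤ (s \ F).card • z t := by
    apply Finset.sum_le_card_nsmul
    intro i hi
    apply hz
    simp [hF] at hi
    simp only [t, Fin.le_def]; omega
  have h2 : (F \ s).card • z t ≤ ∑ i ∈ F \ s, z i := by
    apply Finset.card_nsmul_le_sum
    intro i hi
    apply hz
    simp [hF] at hi
    simp only [t, Fin.le_def]; omega
  have h3 : (s \ F).card = (F \ s).card := by
    have a1 := Finset.card_sdiff_add_card_inter s F
    have a2 := Finset.card_sdiff_add_card_inter F s
    rw [Finset.inter_comm] at a2
    omega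
  have e1 := Finset.sum_inter_add_sum_sdiff s F z
  have e2 := Finset.sum_inter_add_sum_sdiff F s z
  rw [Finset.inter_comm] at e2
  rw [h3] at h1
  linarith

lemma aux_kMax_ge {d : ℕ} (v : Fin d → ℝ) (s : Finset (Fin d)) :
    ∑ i ∈ s, v i ≤ kMaxSum v s.card :=
  le_csSup (Set.toFinite _).bddAbove ⟨s, rfl, rfl⟩

lemma aux_card_pre {d k : ℕ} (hk : k ≤ d) :
    (Finset.univ.filter (fun i : Fin d => i.val < k)).card = k := by
  have : (Finset.univ.filter (fun i : Fin d => i.val < k)).card = (Finset.range k).card := by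
    refine Finset.card_bij (fun i _ => i.val) ?_ ?_ ?_
    · intro i hi
      simpa using hi
    · intro i _ j _ h
      exact Fin.ext h
    · intro b hb
      have hb' := Finset.mem_range.1 hb
      exact ⟨⟨b, by omega⟩, by simpa using hb', rfl⟩
  simpa using this

lemma aux_kMax_le {d : ℕ} (v : Fin d → ℝ) (q : Equiv.Perm (Fin d)) (hq : Antitone (v ∘ q))
    (k : ℕ) (hk : k ≤ d) : kMaxSum v k ≤ ∑ i with i.val < k, v (q i) := by
  apply csSup_le
  · exact ⟨_, _, aux_card_pre hk, rfl⟩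
  · rintro _ ⟨s, hs, rfl⟩
    have hs' : s.card = k := hs
    have := aux_prefix (v ∘ q) hq (s.map q.symm.toEmbedding)
    simpa [hs'] using this

lemma aux_pre_le {d : ℕ} (v : Fin d → ℝ) (q : Equiv.Perm (Fin d)) 
    (k : ℕ) (hk : k ≤ d) : ∑ i with i.val < k, v (q i) ≤ kMaxSum v k := by
  have := aux_kMax_ge v ((Finset.univ.filter (fun i : Fin d => i.val < k)).map q.toEmbedding)
  rw [Finset.card_map, aux_card_pre hk] at this
  simpa using this

lemma aux_kMax_all {d : ℕ} (v : Fin d → ℝ) : kMaxSum v d = ∑ i, v i := by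
  have : {s : Finset (Fin d) | s.card = d} = {Finset.univ} := by
    ext s
    have := Finset.card_eq_iff_eq_univ s
    simpa using this
  simp [kMaxSum, this]

lemma aux_sort {d : ℕ} (v : Fin d → ℝ) : ∃ q : Equiv.Perm (Fin d), Antitone (v ∘ q) := by
  refine ⟨Tuple.sort (fun i => - v i), ?_⟩
  intro i j hij
  have := Tuple.monotone_sort (fun i => - v i) hij
  simpa using this

lemma aux_hull {d : ℕ} (x y : Fin d → ℝ) (h : vMaj x y) :
    x ∈ convexHull ℝ (Set.range fun π : Equiv.Perm (Fin d) => y ∘ π) := by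
  by_contra hx
  obtain ⟨f, u, hf, hu⟩ := geometric_hahn_banach_closed_point (convex_convexHull ℝ _)
    (Set.Finite.isClosed_convexHull ℝ (Set.finite_range _)) hx
  set c : Fin d → ℝ := fun i => f (Pi.single i 1) with hc
  have hfc : ∀ v : Fin d → ℝ, f v = ∑ i, c i * v i := by
    intro v
    have := LinearMap.pi_apply_eq_sum_univ f.toLinearMap v
    simp only [ContinuousLinearMap.coe_coe, smul_eq_mul] at this
    rw [this]
    refine Finset.sum_congr rfl fun i _ => ?_
    rw [mul_comm, hc]
    congr 2
    ext j
    simp [Pi.single_apply, eq_comm]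
  obtain ⟨p, hp⟩ := aux_sort c
  obtain ⟨q, hq⟩ := aux_sort y
  have key := aux_abel_fin (c ∘ p) (fun i => y (q i) - x (p i)) hp (by
    intro k hk
    rw [Finset.sum_sub_distrib]
    rcases Nat.eq_zero_or_pos k with h0 | h0
    · simp [h0]
    have := aux_kMax_le y q hq k hk
    have := aux_pre_le x p k hk
    have := h.1 k h0 hk
    linarith) (by
    have h2 := h.2
    rw [aux_kMax_all, aux_kMax_all] at h2
    rw [Finset.sum_sub_distrib, Equiv.sum_comp q y, Equiv.sum_comp p x, h2, sub_self])
  have h1 := hf (y ∘ (p.symm.trans q)) (subset_convexHull ℝ _ ⟨_, rfl⟩)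
  rw [hfc] at h1 hu
  rw [← Equiv.sum_comp p] at h1 hu
  simp only [Function.comp, mul_sub, Finset.sum_sub_distrib, Equiv.trans_apply,
    Equiv.symm_apply_apply] at h1 key
  linarith

def AuxU {d : ℕ} (U : Matrix (Fin d) (Fin d) ℂ) : Prop := U * Uᴴ = 1 ∧ Uᴴ * U = 1

lemma AuxU.mul {d : ℕ} {U V : Matrix (Fin d) (Fin d) ℂ} (hU : AuxU U) (hV : AuxU V) :
    AuxU (U * V) := by
  constructor
  · rw [conjTranspose_mul, Matrix.mul_assoc, ← Matrix.mul_assoc V, hV.1, Matrix.one_mul, hU.1]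
  · rw [conjTranspose_mul, Matrix.mul_assoc, ← Matrix.mul_assoc Uᴴ, hU.2, Matrix.one_mul, hV.2]

lemma AuxU.star {d : ℕ} {U : Matrix (Fin d) (Fin d) ℂ} (hU : AuxU U) : AuxU Uᴴ := by
  simpa [AuxU] using hU.symm

lemma AuxU.trace {d : ℕ} {U : Matrix (Fin d) (Fin d) ℂ} (hU : AuxU U)
    (A : Matrix (Fin d) (Fin d) ℂ) : (U * A * Uᴴ).trace = A.trace := by
  rw [Matrix.trace_mul_comm, ← Matrix.mul_assoc, hU.2, Matrix.one_mul]

lemma AuxU.perm {d : ℕ} (π : Equiv.Perm (Fin d)) : AuxU (π.permMatrix ℂ) := by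
  constructor
  · rw [conjTranspose_permMatrix, ← permMatrix_mul]; simp
  · rw [conjTranspose_permMatrix, ← permMatrix_mul]; simp

lemma aux_spec {d : ℕ} {A : Matrix (Fin d) (Fin d) ℂ} (hA : A.IsHermitian) :
    ∃ U, AuxU U ∧ A = U * diagonal (fun i => (eigs A i : ℂ)) * Uᴴ := by
  refine ⟨hA.eigenvectorUnitary, ⟨?_, ?_⟩, ?_⟩
  · exact Unitary.coe_mul_star_self _
  · exact Unitary.coe_star_mul_self _
  · have := hA.spectral_theorem
    rw [Unitary.conjStarAlgAut_apply] at this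
    simp only [eigs, hA, dif_pos]
    exact this

def AuxTN {d : ℕ} (A : Matrix (Fin d) (Fin d) ℂ) (t : ℝ) : Prop :=
  ∃ P Q : Matrix (Fin d) (Fin d) ℂ, P.PosSemidef ∧ Q.PosSemidef ∧ A = P - Q ∧
    P.trace.re + Q.trace.re ≤ t

lemma aux_TN_iff {d : ℕ} {A : Matrix (Fin d) (Fin d) ℂ} (hA : A.IsHermitian) (t : ℝ) :
    traceNorm A ≤ t ↔ AuxTN A t := by
  obtain ⟨U, hU, h⟩ := aux_spec hA
  constructor
  · intro ht
    have hpsd : ∀ v : Fin d → ℝ, (∀ i, 0 ≤ v i) →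
        (U * diagonal (fun i => (v i : ℂ)) * Uᴴ).PosSemidef := by
      intro v hv
      apply PosSemidef.mul_mul_conjTranspose_same
      rw [posSemidef_diagonal_iff]
      intro i
      exact_mod_cast hv i
    refine ⟨_, _, hpsd (fun i => max (eigs A i) 0) (fun i => le_max_right _ _),
      hpsd (fun i => max (-eigs A i) 0) (fun i => le_max_right _ _), ?_, ?_⟩
    · rw [← Matrix.sub_mul, ← Matrix.mul_sub, diagonal_sub]
      conv_lhs => rw [h]
      congr 3
      funext i
      rw [← Complex.ofReal_sub]
      congr 1
      rcases le_total 0 (eigs A i) with h0 | h0 <;> simp [h0]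
    · rw [hU.trace, hU.trace, trace_diagonal, trace_diagonal, Complex.re_sum, Complex.re_sum,
        ← Finset.sum_add_distrib]
      refine le_trans (le_of_eq ?_) ht
      refine Finset.sum_congr rfl fun i _ => ?_
      simp only [Complex.ofReal_re]
      rcases le_total 0 (eigs A i) with h0 | h0 <;> simp [h0, abs_of_nonneg, abs_of_nonpos]
  · rintro ⟨P, Q, hP, hQ, hPQ, hle⟩
    refine le_trans ?_ hle
    have hP' := hP.conjTranspose_mul_mul_same U
    have hQ' := hQ.conjTranspose_mul_mul_same U
    have eP := hU.star.trace P
    have eQ := hU.star.trace Q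
    rw [conjTranspose_conjTranspose] at eP eQ
    rw [← eP, ← eQ, Matrix.trace, Matrix.trace, Complex.re_sum, Complex.re_sum,
        ← Finset.sum_add_distrib]
    refine Finset.sum_le_sum fun i _ => ?_
    have hd : Uᴴ * P * U - Uᴴ * Q * U = diagonal (fun i => (eigs A i : ℂ)) := by
      rw [← Matrix.sub_mul, ← Matrix.mul_sub, ← hPQ]
      conv_lhs => rw [h]
      rw [Matrix.mul_assoc, Matrix.mul_assoc, hU.2, Matrix.mul_one, ← Matrix.mul_assoc, hU.2,
        Matrix.one_mul]
    have hi := congrArg (fun M => (M i i).re) hd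
    simp at hi
    have p0 : 0 ≤ ((Uᴴ * P * U) i i).re := (Complex.le_def.1 hP'.diag_nonneg).1
    have q0 : 0 ≤ ((Uᴴ * Q * U) i i).re := (Complex.le_def.1 hQ'.diag_nonneg).1
    simp only [diag_apply]
    rw [← hi]
    exact abs_le.2 ⟨by linarith, by linarith⟩

lemma AuxTN.add {d : ℕ} {A B : Matrix (Fin d) (Fin d) ℂ} {s t : ℝ} (hA : AuxTN A s)
    (hB : AuxTN B t) : AuxTN (A + B) (s + t) := by
  obtain ⟨P, Q, hP, hQ, e, h⟩ := hA
  obtain ⟨P', Q', hP', hQ', e', h'⟩ := hB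
  refine ⟨P + P', Q + Q', hP.add hP', hQ.add hQ', by rw [e, e']; abel, ?_⟩
  simp only [trace_add, Complex.add_re]
  linarith

lemma aux_psd_smul {d : ℕ} {A : Matrix (Fin d) (Fin d) ℂ} (hA : A.PosSemidef) {r : ℝ}
    (hr : 0 ≤ r) : (r • A).PosSemidef := hA.smul hr

lemma AuxTN.smul {d : ℕ} {A : Matrix (Fin d) (Fin d) ℂ} {t : ℝ} (hA : AuxTN A t) {r : ℝ}
    (hr : 0 ≤ r) : AuxTN (r • A) (r * t) := by
  obtain ⟨P, Q, hP, hQ, e, h⟩ := hA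
  refine ⟨r • P, r • Q, aux_psd_smul hP hr, aux_psd_smul hQ hr, by rw [e, smul_sub], ?_⟩
  simp only [trace_smul, Complex.smul_re, smul_eq_mul]
  nlinarith

lemma AuxTN.conj {d : ℕ} {A : Matrix (Fin d) (Fin d) ℂ} {t : ℝ} (hA : AuxTN A t)
    {U : Matrix (Fin d) (Fin d) ℂ} (hU : AuxU U) : AuxTN (U * A * Uᴴ) t := by
  obtain ⟨P, Q, hP, hQ, e, h⟩ := hA
  refine ⟨_, _, hP.mul_mul_conjTranspose_same U, hQ.mul_mul_conjTranspose_same U,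
    by rw [e, Matrix.mul_sub, Matrix.sub_mul], ?_⟩
  rwa [hU.trace, hU.trace]

lemma aux_ball {d : ℕ} (ε : ℝ) (σ ω : MState d) :
    inBall ε σ ω ↔ AuxTN (ω.1 - σ.1) (2 * ε) := by
  rw [← aux_TN_iff (ω.2.1.isHermitian.sub σ.2.1.isHermitian), inBall]
  constructor <;> intro h <;> linarith

lemma aux_uhlmann {d : ℕ} (ρ ω : MState d) (h : Maj ρ ω) :
    ρ.1 ∈ convexHull ℝ {X | ∃ U, AuxU U ∧ X = U * ω.1 * Uᴴ} := by
  obtain ⟨U, hU, hρ⟩ := aux_spec ρ.2.1.isHermitian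
  obtain ⟨V, hV, hω⟩ := aux_spec ω.2.1.isHermitian
  have hh := aux_hull _ _ h
  let L : (Fin d → ℝ) →ₗ[ℝ] Matrix (Fin d) (Fin d) ℂ :=
    { toFun := fun v => U * diagonal (fun i => (v i : ℂ)) * Uᴴ
      map_add' := by
        intro v w
        rw [← Matrix.add_mul, ← Matrix.mul_add, diagonal_add]
        simp
      map_smul' := by
        intro r v
        rw [RingHom.id_apply, ← Matrix.smul_mul, ← Matrix.mul_smul, ← diagonal_smul]
        congr 3
        funext i
        simp }
  have h1 : L (eigs ρ.1) ∈ L '' (convexHull ℝ (Set.range fun π : Equiv.Perm (Fin d) =>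
    eigs ω.1 ∘ π)) := ⟨_, hh, rfl⟩
  rw [LinearMap.image_convexHull] at h1
  have h2 : L (eigs ρ.1) = ρ.1 := hρ.symm
  rw [h2] at h1
  refine convexHull_mono ?_ h1
  rintro _ ⟨_, ⟨π, rfl⟩, rfl⟩
  refine ⟨U * π.permMatrix ℂ * Vᴴ, (hU.mul (AuxU.perm π)).mul hV.star, ?_⟩
  have hd : diagonal (fun i => ((eigs ω.1 ∘ π) i : ℂ)) =
      π.permMatrix ℂ * diagonal (fun i => (eigs ω.1 i : ℂ)) * (π.permMatrix ℂ)ᴴ := by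
    rw [conjTranspose_permMatrix]
    ext i j
    simp [Equiv.Perm.permMatrix, PEquiv.toMatrix_toPEquiv_mul, PEquiv.mul_toMatrix_toPEquiv, diagonal_apply]
    have e : (Equiv.symm π⁻¹) j = π j := rfl
    rw [e]
    simp
  have hD : Vᴴ * ω.1 * V = diagonal (fun i => (eigs ω.1 i : ℂ)) := by
    conv_lhs => rw [hω]
    rw [Matrix.mul_assoc, Matrix.mul_assoc, hV.2, Matrix.mul_one, ← Matrix.mul_assoc, hV.2,
        Matrix.one_mul]
  change U * diagonal (fun i => ((eigs ω.1 ∘ π) i : ℂ)) * Uᴴ = _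
  rw [hd, ← hD]
  simp only [conjTranspose_mul, conjTranspose_conjTranspose, Matrix.mul_assoc]

def auxF {d : ℕ} (A : Matrix (Fin d) (Fin d) ℂ) : ℝ := ∑ i, ∑ j, Complex.normSq (A i j)

lemma auxF_trace {d : ℕ} (A : Matrix (Fin d) (Fin d) ℂ) : auxF A = (A * Aᴴ).trace.re := by
  simp [auxF, Matrix.trace, Matrix.mul_apply, Complex.normSq_apply]

lemma auxF_conj {d : ℕ} (A : Matrix (Fin d) (Fin d) ℂ) {U : Matrix (Fin d) (Fin d) ℂ}
    (hU : AuxU U) : auxF (U * A * Uᴴ) = auxF A := by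
  rw [auxF_trace, auxF_trace, ← hU.trace (A * Aᴴ)]
  simp only [conjTranspose_mul, conjTranspose_conjTranspose, Matrix.mul_assoc]
  rw [← Matrix.mul_assoc Uᴴ U, hU.2, Matrix.one_mul]

lemma auxF_convex {d : ℕ} (A B : Matrix (Fin d) (Fin d) ℂ) (a b M : ℝ) (ha : 0 ≤ a) (hb : 0 ≤ b)
    (hab : a + b = 1) (hA : auxF A ≤ M) (hB : auxF B ≤ M) : auxF (a • A + b • B) ≤ M := by
  have : auxF (a • A + b • B) ≤ a * auxF A + b * auxF B := by
    simp only [auxF, Finset.mul_sum, ← Finset.sum_add_distrib]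
    refine Finset.sum_le_sum fun i _ => Finset.sum_le_sum fun j _ => ?_
    simp [Complex.normSq_apply]
    obtain rfl : b = 1 - a := by linarith
    nlinarith [mul_nonneg (mul_nonneg ha hb) (sq_nonneg ((A i j).re - (B i j).re)),
      mul_nonneg (mul_nonneg ha hb) (sq_nonneg ((A i j).im - (B i j).im))]
  have h1 := mul_le_mul_of_nonneg_left hA ha
  have h2 := mul_le_mul_of_nonneg_left hB hb
  have h3 : a * M + b * M = M := by rw [← add_mul, hab, one_mul]
  linarith

lemma auxF_par {d : ℕ} (A B : Matrix (Fin d) (Fin d) ℂ) :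
    auxF (A - B) = 2 * auxF A + 2 * auxF B - 4 * auxF ((1/2 : ℝ) • A + (1/2 : ℝ) • B) := by
  simp only [auxF, Finset.mul_sum, ← Finset.sum_add_distrib, ← Finset.sum_sub_distrib]
  refine Finset.sum_congr rfl fun i _ => Finset.sum_congr rfl fun j _ => ?_
  simp [Complex.normSq_apply]
  ring

lemma auxF_eq {d : ℕ} (A B : Matrix (Fin d) (Fin d) ℂ) (h : auxF (A - B) ≤ 0) : A = B := by
  ext i j
  have h1 : ∑ j, Complex.normSq ((A - B) i j) ≤ auxF (A - B) :=
    Finset.single_le_sum (f := fun i => ∑ j, Complex.normSq ((A - B) i j))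
      (fun i _ => Finset.sum_nonneg fun j _ => Complex.normSq_nonneg _) (Finset.mem_univ i)
  have h2 : Complex.normSq ((A - B) i j) ≤ ∑ j, Complex.normSq ((A - B) i j) :=
    Finset.single_le_sum (f := fun j => Complex.normSq ((A - B) i j))
      (fun j _ => Complex.normSq_nonneg _) (Finset.mem_univ j)
  have h3 : Complex.normSq ((A - B) i j) = 0 :=
    le_antisymm (by linarith) (Complex.normSq_nonneg _)
  rw [Complex.normSq_eq_zero] at h3
  exact sub_eq_zero.1 h3

lemma auxF_maj {d : ℕ} (ρ ω : MState d) (h : Maj ρ ω) : auxF ρ.1 ≤ auxF ω.1 := by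
  have h1 := aux_uhlmann ρ ω h
  have h2 : convexHull ℝ {X | ∃ U, AuxU U ∧ X = U * ω.1 * Uᴴ} ⊆ {X | auxF X ≤ auxF ω.1} := by
    apply convexHull_min
    · rintro _ ⟨U, hU, rfl⟩
      exact (auxF_conj _ hU).le
    · intro A hA B hB a b ha hb hab
      exact auxF_convex A B a b _ ha hb hab hA hB
  exact h2 h1

lemma aux_state {d : ℕ} {A B : Matrix (Fin d) (Fin d) ℂ} (hA : A.PosSemidef ∧ A.trace = 1)
    (hB : B.PosSemidef ∧ B.trace = 1) {a b : ℝ} (ha : 0 ≤ a) (hb : 0 ≤ b) (hab : a + b = 1) :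
    (a • A + b • B).PosSemidef ∧ (a • A + b • B).trace = 1 := by
  refine ⟨(aux_psd_smul hA.1 ha).add (aux_psd_smul hB.1 hb), ?_⟩
  rw [trace_add, trace_smul, trace_smul, hA.2, hB.2, ← add_smul, hab, one_smul]

/-- If `ρ ≺ ω` and `τ₀` is `t`-close to `ω`, some `τ` is `t`-close to `ρ` with smaller norm. -/
lemma aux_transport {d : ℕ} (ρ ω τ₀ : MState d) (h : Maj ρ ω) (t : ℝ)
    (ht : AuxTN (τ₀.1 - ω.1) t) :
    ∃ τ : MState d, AuxTN (τ.1 - ρ.1) t ∧ auxF τ.1 ≤ auxF τ₀.1 := by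
  have h1 := aux_uhlmann ρ ω h
  have h2 : convexHull ℝ {X | ∃ U, AuxU U ∧ X = U * ω.1 * Uᴴ} ⊆
      {X | ∃ τ : MState d, AuxTN (τ.1 - X) t ∧ auxF τ.1 ≤ auxF τ₀.1} := by
    apply convexHull_min
    · rintro _ ⟨U, hU, rfl⟩
      refine ⟨⟨U * τ₀.1 * Uᴴ, τ₀.2.1.mul_mul_conjTranspose_same U, ?_⟩, ?_, ?_⟩
      · rw [hU.trace, τ₀.2.2]
      · have := ht.conj hU
        rwa [Matrix.mul_sub, Matrix.sub_mul] at this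
      · exact (auxF_conj _ hU).le
    · rintro A ⟨τ, hA, hA'⟩ B ⟨τ', hB, hB'⟩ a b ha hb hab
      refine ⟨⟨a • τ.1 + b • τ'.1, aux_state τ.2 τ'.2 ha hb hab⟩, ?_,
        auxF_convex _ _ a b _ ha hb hab hA' hB'⟩
      have := (hA.smul ha).add (hB.smul hb)
      rw [← add_mul, hab, one_mul] at this
      convert this using 1
      simp only [smul_sub]
      abel
  exact h2 h1

lemma aux_m1 {d : ℕ} (S R : Matrix (Fin d) (Fin d) ℂ) (a b : ℝ) (h : a + b = 1) :
    a • S + b • R - S = b • (R - S) := by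
  obtain rfl : a = 1 - b := by linarith
  module

lemma aux_m2 {d : ℕ} (S R : Matrix (Fin d) (Fin d) ℂ) (a b : ℝ) (h : a + b = 1) :
    R - (a • S + b • R) = a • (R - S) := by
  obtain rfl : a = 1 - b := by linarith
  module

lemma aux_m3 {d : ℕ} (S R T : Matrix (Fin d) (Fin d) ℂ) :
    (1/2 : ℝ) • R + (1/2 : ℝ) • T - S = (1/2 : ℝ) • (R - S) + (1/2 : ℝ) • (T - S) := by
  module

lemma AuxTN.le {d : ℕ} {A : Matrix (Fin d) (Fin d) ℂ} {s t : ℝ} (h : AuxTN A s) (hst : s = t) :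
    AuxTN A t := hst ▸ h

/-- Semigroup property: `ρ*_{ε₁+ε₂}(σ) = ρ*_{ε₁}(ρ*_{ε₂}(σ))`. -/
theorem minState_semigroup
    {d : ℕ} (hd : 1 ≤ d) (σ : MState d) (ε₁ ε₂ : ℝ)
    (hε₁ : ε₁ ∈ Set.Ioc (0 : ℝ) 1) (hε₂ : ε₂ ∈ Set.Ioc (0 : ℝ) 1)
    (ρ₂ ρ₁₂ ρ' : MState d)
    (hρ₂ : IsMinState ε₂ σ ρ₂)
    (hρ₁₂ : IsMinState (ε₁ + ε₂) σ ρ₁₂)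
    (hρ' : IsMinState ε₁ ρ₂ ρ') :
    ρ₁₂ = ρ' := by
  obtain ⟨e1, -⟩ := hε₁
  obtain ⟨e2, -⟩ := hε₂
  have hs : 0 < ε₁ + ε₂ := by linarith
  obtain ⟨hb12, hm12⟩ := hρ₁₂
  obtain ⟨hb2, hm2⟩ := hρ₂
  obtain ⟨hb', hm'⟩ := hρ'
  have hball12 := (aux_ball _ _ _).1 hb12
  have hball2 := (aux_ball _ _ _).1 hb2
  have hball' := (aux_ball _ _ _).1 hb'
  -- `ρ'` lies in the large ball
  have hbig : AuxTN (ρ'.1 - σ.1) (2 * (ε₁ + ε₂)) := by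
    have := hball'.add hball2
    rw [sub_add_sub_cancel] at this
    rwa [mul_add]
  -- intermediate state
  have hab : ε₁ / (ε₁ + ε₂) + ε₂ / (ε₁ + ε₂) = 1 := by field_simp
  have ha : 0 ≤ ε₁ / (ε₁ + ε₂) := by positivity
  have hb : 0 ≤ ε₂ / (ε₁ + ε₂) := by positivity
  obtain ⟨ω, hω0⟩ : ∃ ω : MState d,
      ω.1 = (ε₁ / (ε₁ + ε₂)) • σ.1 + (ε₂ / (ε₁ + ε₂)) • ρ₁₂.1 :=
    ⟨⟨_, aux_state σ.2 ρ₁₂.2 ha hb hab⟩, rfl⟩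
  have w1 : ω.1 - σ.1 = (ε₂ / (ε₁ + ε₂)) • (ρ₁₂.1 - σ.1) := by
    rw [hω0]; exact aux_m1 _ _ _ _ hab
  have w2 : ρ₁₂.1 - ω.1 = (ε₁ / (ε₁ + ε₂)) • (ρ₁₂.1 - σ.1) := by
    rw [hω0]; exact aux_m2 _ _ _ _ hab
  have hω : inBall ε₂ σ ω := by
    rw [aux_ball, w1]
    exact (hball12.smul hb).le (by field_simp)
  have hω' : AuxTN (ρ₁₂.1 - ω.1) (2 * ε₁) := by
    rw [w2]
    exact (hball12.smul ha).le (by field_simp)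
  obtain ⟨τ, hτ, hτF⟩ := aux_transport ρ₂ ω ρ₁₂ (hm2 ω hω) _ hω'
  have f1 := auxF_maj _ _ (hm' τ ((aux_ball _ _ _).2 hτ))
  -- midpoint
  obtain ⟨μ, hμ0⟩ : ∃ μ : MState d, μ.1 = (1/2 : ℝ) • ρ₁₂.1 + (1/2 : ℝ) • ρ'.1 :=
    ⟨⟨_, aux_state ρ₁₂.2 ρ'.2 (by norm_num) (by norm_num) (by norm_num)⟩, rfl⟩
  have hμ : inBall (ε₁ + ε₂) σ μ := by
    rw [aux_ball]
    have h3 : μ.1 - σ.1 = (1/2 : ℝ) • (ρ₁₂.1 - σ.1) + (1/2 : ℝ) • (ρ'.1 - σ.1) := by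
      rw [hμ0]; exact aux_m3 _ _ _
    rw [h3]
    exact ((hball12.smul (r := 1/2) (by norm_num)).add
      (hbig.smul (r := 1/2) (by norm_num))).le (by ring)
  have f2 := auxF_maj _ _ (hm12 μ hμ)
  rw [hμ0] at f2
  apply Subtype.ext
  apply auxF_eq
  rw [auxF_par]
  linarith
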